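/- Let n ≥ 2, let Ω ⊆ ℝⁿ be an open connected set, let G : ℝ → ℝ be a smooth function satisfying G > 0, G' < 0 and G·G'' ≤ (n/(n−1))·(G')² everywhere, and let u : Ω → ℝ be a smooth convex solution of Δu = G(u) in Ω. If the function x ↦ det(D²u(x)) attains a local minimum at an interior point of Ω, then det(D²u(x)) = 0 for every x ∈ Ω. -/

import Mathlib

/-- The Hessian matrix of `u : ℝⁿ → ℝ` at `x`, with entries `∂²u/∂xᵢ∂xⱼ(x)`. -/
noncomputable def hessian {n : ℕ} (u : EuclideanSpace ℝ (Fin n) → ℝ)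
    (x : EuclideanSpace ℝ (Fin n)) : Matrix (Fin n) (Fin n) ℝ :=
  Matrix.of fun i j =>
    iteratedFDeriv ℝ 2 u x
      ![EuclideanSpace.basisFun (Fin n) ℝ i, EuclideanSpace.basisFun (Fin n) ℝ j]

section Calc
variable {E : Type*} [NormedAddCommGroup E] [NormedSpace ℝ E]

noncomputable def dd (v : E) (f : E → ℝ) : E → ℝ := fun x => fderiv ℝ f x v

def Sm (Ω : Set E) (f : E → ℝ) : Prop := ContDiffOn ℝ (⊤ : ℕ∞) f Ω

variable {Ω : Set E} (hΩ : IsOpen Ω) {f g : E → ℝ} {x : E}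

theorem Sm.cda (hf : Sm Ω f) (hΩ : IsOpen Ω) (hx : x ∈ Ω) : ContDiffAt ℝ (⊤ : ℕ∞) f x :=
  ContDiffOn.contDiffAt hf (hΩ.mem_nhds hx)

theorem Sm.da (hf : Sm Ω f) (hΩ : IsOpen Ω) (hx : x ∈ Ω) : DifferentiableAt ℝ f x :=
  (hf.cda hΩ hx).differentiableAt (by simp)

theorem Sm.dd (hf : Sm Ω f) (hΩ : IsOpen Ω) (v : E) : Sm Ω (dd v f) := by
  have h1 : ContDiffOn ℝ (⊤ : ℕ∞) (fderiv ℝ f) Ω :=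
    ContDiffOn.fderiv_of_isOpen hf hΩ (by exact_mod_cast le_rfl)
  exact h1.clm_apply contDiffOn_const

theorem Sm.add (hf : Sm Ω f) (hg : Sm Ω g) : Sm Ω (fun x => f x + g x) := ContDiffOn.add hf hg
theorem Sm.sub (hf : Sm Ω f) (hg : Sm Ω g) : Sm Ω (fun x => f x - g x) := ContDiffOn.sub hf hg
theorem Sm.mul (hf : Sm Ω f) (hg : Sm Ω g) : Sm Ω (fun x => f x * g x) := ContDiffOn.mul hf hg
theorem Sm.const (c : ℝ) : Sm Ω (fun _ => c) := contDiffOn_const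
theorem Sm.sum {ι : Type*} {s : Finset ι} {F : ι → E → ℝ} (h : ∀ i ∈ s, Sm Ω (F i)) :
    Sm Ω (fun x => ∑ i ∈ s, F i x) := ContDiffOn.sum h
theorem Sm.prod {ι : Type*} {s : Finset ι} {F : ι → E → ℝ} (h : ∀ i ∈ s, Sm Ω (F i)) :
    Sm Ω (fun x => ∏ i ∈ s, F i x) := contDiffOn_prod h
theorem Sm.comp {h : ℝ → ℝ} (hh : ContDiff ℝ (⊤ : ℕ∞) h) (hf : Sm Ω f) :
    Sm Ω (fun x => h (f x)) := hh.comp_contDiffOn hf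

theorem dd_congr (hΩ : IsOpen Ω) (h : ∀ y ∈ Ω, f y = g y) (v : E) (hx : x ∈ Ω) :
    dd v f x = dd v g x := by
  unfold dd
  rw [Filter.EventuallyEq.fderiv_eq (Filter.eventuallyEq_of_mem (hΩ.mem_nhds hx) h)]

theorem dd_add (hf : DifferentiableAt ℝ f x) (hg : DifferentiableAt ℝ g x) (v : E) :
    dd v (fun y => f y + g y) x = dd v f x + dd v g x := by
  unfold dd; rw [fderiv_fun_add hf hg]; rfl
theorem dd_sub (hf : DifferentiableAt ℝ f x) (hg : DifferentiableAt ℝ g x) (v : E) :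
    dd v (fun y => f y - g y) x = dd v f x - dd v g x := by
  unfold dd; rw [fderiv_fun_sub hf hg]; rfl
theorem dd_mul (hf : DifferentiableAt ℝ f x) (hg : DifferentiableAt ℝ g x) (v : E) :
    dd v (fun y => f y * g y) x = f x * dd v g x + dd v f x * g x := by
  unfold dd; rw [fderiv_fun_mul hf hg]; simp [mul_comm]
theorem dd_const_mul (c : ℝ) (hg : DifferentiableAt ℝ g x) (v : E) :
    dd v (fun y => c * g y) x = c * dd v g x := by
  unfold dd; rw [fderiv_const_mul hg]; simp
theorem dd_const (c : ℝ) (v : E) : dd v (fun _ => c) x = 0 := by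
  simp [dd]
theorem dd_sum {ι : Type*} {s : Finset ι} {F : ι → E → ℝ}
    (h : ∀ i ∈ s, DifferentiableAt ℝ (F i) x) (v : E) :
    dd v (fun y => ∑ i ∈ s, F i y) x = ∑ i ∈ s, dd v (F i) x := by
  unfold dd; rw [fderiv_fun_sum h]; simp
theorem dd_prod {ι : Type*} [DecidableEq ι] {s : Finset ι} {F : ι → E → ℝ}
    (h : ∀ i ∈ s, DifferentiableAt ℝ (F i) x) (v : E) :
    dd v (fun y => ∏ i ∈ s, F i y) x = ∑ i ∈ s, (∏ j ∈ s.erase i, F j x) * dd v (F i) x := by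
  unfold dd; rw [(HasFDerivAt.finsetProd fun i hi => (h i hi).hasFDerivAt).fderiv]; simp
theorem dd_comp {h : ℝ → ℝ} (hh : DifferentiableAt ℝ h (f x)) (hf : DifferentiableAt ℝ f x)
    (v : E) : dd v (fun y => h (f y)) x = deriv h (f x) * dd v f x := by
  unfold dd
  have := hh.hasDerivAt.comp_hasFDerivAt x hf.hasFDerivAt
  have h2 : fderiv ℝ (fun y => h (f y)) x = deriv h (f x) • fderiv ℝ f x := this.fderiv
  rw [h2]; simp

theorem dd_dd (hf : Sm Ω f) (hΩ : IsOpen Ω) (hx : x ∈ Ω) (v w : E) :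
    dd v (dd w f) x = fderiv ℝ (fderiv ℝ f) x v w := by
  have h1 : ContDiffOn ℝ (⊤ : ℕ∞) (fderiv ℝ f) Ω :=
    ContDiffOn.fderiv_of_isOpen hf hΩ (by exact_mod_cast le_rfl)
  have h2 : DifferentiableAt ℝ (fderiv ℝ f) x :=
    (h1.contDiffAt (hΩ.mem_nhds hx)).differentiableAt (by simp)
  have := (h2.hasFDerivAt.clm_apply (hasFDerivAt_const w x)).fderiv
  unfold dd
  rw [this]; simp

theorem dd_comm (hf : Sm Ω f) (hΩ : IsOpen Ω) (hx : x ∈ Ω) (v w : E) :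
    dd v (dd w f) x = dd w (dd v f) x := by
  rw [dd_dd hf hΩ hx, dd_dd hf hΩ hx]
  exact ((hf.cda hΩ hx).isSymmSndFDerivAt (by simp; exact WithTop.coe_le_coe.2 le_top)) v w

theorem dd_line (v : E) (t : ℝ) (hf : DifferentiableAt ℝ f (x + t • v)) :
    HasDerivAt (fun s : ℝ => f (x + s • v)) (dd v f (x + t • v)) t := by
  have h1 : HasDerivAt (fun s : ℝ => x + s • v) v t := by
    simpa using ((hasDerivAt_id t).smul_const v).const_add x
  exact hf.hasFDerivAt.comp_hasDerivAt t h1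

theorem localMin_test (hf : Sm Ω f) (hΩ : IsOpen Ω) (hx : x ∈ Ω) (hm : IsLocalMin f x) (v : E) :
    dd v f x = 0 ∧ 0 ≤ dd v (dd v f) x := by
  have h0 : dd v f x = 0 := by
    unfold dd; rw [hm.fderiv_eq_zero]; rfl
  refine ⟨h0, ?_⟩
  by_contra hneg
  push Not at hneg
  have hc : Continuous (fun s : ℝ => x + s • v) := by fun_prop
  have hx0 : x + (0:ℝ) • v = x := by simp
  have hev : ∀ᶠ s in nhds (0:ℝ), x + s • v ∈ Ω :=
    hc.continuousAt.eventually_mem (by rw [hx0]; exact hΩ.mem_nhds hx)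
  set k : ℝ → ℝ := fun s => f (x + s • v) with hk
  have hd1 : deriv k =ᶠ[nhds 0] fun s => dd v f (x + s • v) := by
    filter_upwards [hev] with s hs
    exact (dd_line v s (hf.da hΩ hs)).deriv
  have hd2 : deriv (deriv k) 0 = dd v (dd v f) x := by
    rw [hd1.deriv_eq]
    have := (dd_line (f := dd v f) (x := x) v 0 (by rw [hx0]; exact (hf.dd hΩ v).da hΩ hx)).deriv
    rw [this, hx0]
  have hd0 : deriv k 0 = 0 := by
    rw [hd1.self_of_nhds]; simp [h0]
  have hcont : ContinuousAt k 0 := (dd_line v 0 (by rw [hx0]; exact hf.da hΩ hx)).continuousAt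
  have hmax := isLocalMax_of_deriv_deriv_neg (by rw [hd2]; exact hneg) hd0 hcont
  have hmin : ∀ᶠ s in nhds (0:ℝ), k 0 ≤ k s := by
    have : Filter.Tendsto (fun s : ℝ => x + s • v) (nhds 0) (nhds x) := by
      have := hc.tendsto 0; rwa [hx0] at this
    have h3 := this.eventually hm
    filter_upwards [h3] with s hs
    simpa [hk] using hs
  have hconst : k =ᶠ[nhds 0] fun _ => k 0 := by
    filter_upwards [hmin, hmax] with s h1 h2
    exact le_antisymm h2 h1
  have h4 : deriv k =ᶠ[nhds 0] fun _ => 0 := by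
    have := hconst.deriv
    filter_upwards [this] with s hs
    rw [hs]; simp
  rw [h4.deriv_eq] at hd2
  simp at hd2
  linarith
end Calc

section Det
variable {E : Type*} [NormedAddCommGroup E] [NormedSpace ℝ E] {n : ℕ}

theorem Sm.det {Ω : Set E} {M : E → Matrix (Fin n) (Fin n) ℝ}
    (hM : ∀ i j, Sm Ω (fun x => M x i j)) : Sm Ω (fun x => (M x).det) := by
  simp_rw [Matrix.det_apply']
  exact Sm.sum fun σ _ => (Sm.const _).mul (Sm.prod fun i _ => hM _ _)

theorem Sm.adj {Ω : Set E} {M : E → Matrix (Fin n) (Fin n) ℝ}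
    (hM : ∀ i j, Sm Ω (fun x => M x i j)) (i j : Fin n) :
    Sm Ω (fun x => (M x).adjugate i j) := by
  simp_rw [Matrix.adjugate_apply]
  apply Sm.det
  intro a b
  by_cases h : a = j
  · subst h; simp only [Matrix.updateRow_self]; exact Sm.const _
  · simp only [Matrix.updateRow_ne h]; exact hM a b

theorem dd_det {M : E → Matrix (Fin n) (Fin n) ℝ} {x : E}
    (hM : ∀ i j, DifferentiableAt ℝ (fun x => M x i j) x) (v : E) :
    dd v (fun x => (M x).det) x
      = ∑ i, ∑ j, (M x).adjugate i j * dd v (fun x => M x j i) x := by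
  have hP : ∀ σ : Equiv.Perm (Fin n), DifferentiableAt ℝ (fun x => ∏ i, M x (σ i) i) x := by
    intro σ
    have := fun i (_ : i ∈ (Finset.univ : Finset (Fin n))) => (hM (σ i) i).hasFDerivAt
    exact (HasFDerivAt.finsetProd this).differentiableAt
  simp_rw [Matrix.det_apply']
  rw [dd_sum (fun σ _ => (hP σ).const_mul _)]
  simp_rw [dd_const_mul _ (hP _), dd_prod (fun i _ => hM _ i), Finset.mul_sum]
  rw [Finset.sum_comm]
  refine Finset.sum_congr rfl fun i _ => ?_
  have h1 : ∑ j, (M x).adjugate i j * dd v (fun x => M x j i) x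
      = ((M x).updateCol i (fun j => dd v (fun x => M x j i) x)).det := by
    rw [← Matrix.cramer_apply, Matrix.cramer_eq_adjugate_mulVec]; rfl
  rw [h1, Matrix.det_apply']
  refine Finset.sum_congr rfl fun σ _ => ?_
  rw [← Finset.mul_prod_erase _ _ (Finset.mem_univ i)]
  simp only [Matrix.updateCol_self]
  rw [mul_comm (dd v _ x)]
  congr 2
  refine Finset.prod_congr rfl fun j hj => ?_
  rw [Matrix.updateCol_ne (Finset.ne_of_mem_erase hj)]
end Det


section Euc
variable {n : ℕ} {Ω : Set (EuclideanSpace ℝ (Fin n))} {u : EuclideanSpace ℝ (Fin n) → ℝ}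
  {x : EuclideanSpace ℝ (Fin n)}

theorem dd_quad (hu : Sm Ω u) (hΩ : IsOpen Ω) (hx : x ∈ Ω) (v w : EuclideanSpace ℝ (Fin n)) :
    dd v (dd w u) x = v.ofLp ⬝ᵥ (hessian u x).mulVec w.ofLp := by
  rw [dd_dd hu hΩ hx]
  have hv := (EuclideanSpace.basisFun (Fin n) ℝ).sum_repr v
  have hw := (EuclideanSpace.basisFun (Fin n) ℝ).sum_repr w
  conv_lhs => rw [← hv, ← hw]
  simp only [map_sum, map_smul, dotProduct, Matrix.mulVec, hessian, iteratedFDeriv_two_apply]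
  simp only [ContinuousLinearMap.sum_apply, ContinuousLinearMap.smul_apply, Finset.mul_sum,
    smul_eq_mul]
  rw [Finset.sum_comm]
  refine Finset.sum_congr rfl fun i _ => Finset.sum_congr rfl fun j _ => ?_
  simp
  ring

theorem hess_eq (hu : Sm Ω u) (hΩ : IsOpen Ω) (hx : x ∈ Ω) 
    (b : OrthonormalBasis (Fin n) ℝ (EuclideanSpace ℝ (Fin n))) :
    (Matrix.of fun i j => dd (b i) (dd (b j) u) x) =
      (Matrix.of fun k i => b k i) * hessian u x * (Matrix.of fun k i => b k i).transpose := by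
  ext i j
  rw [Matrix.of_apply, dd_quad hu hΩ hx, Matrix.mul_assoc, Matrix.mul_apply]
  simp [dotProduct, Matrix.mulVec, Matrix.mul_apply]

theorem bmat_mul (b : OrthonormalBasis (Fin n) ℝ (EuclideanSpace ℝ (Fin n))) :
    (Matrix.of fun k i => b k i) * (Matrix.of fun k i => b k i).transpose =
      (1 : Matrix (Fin n) (Fin n) ℝ) := by
  ext i j
  have := (orthonormal_iff_ite.1 b.orthonormal) j i
  rw [PiLp.inner_apply] at this
  simp [Matrix.mul_apply, Matrix.one_apply] at this ⊢
  rw [this]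
  simp [eq_comm]

theorem det_eq (hu : Sm Ω u) (hΩ : IsOpen Ω) (hx : x ∈ Ω) 
    (b : OrthonormalBasis (Fin n) ℝ (EuclideanSpace ℝ (Fin n))) :
    (Matrix.of fun i j => dd (b i) (dd (b j) u) x).det = (hessian u x).det := by
  rw [hess_eq hu hΩ hx, Matrix.det_mul_comm, ← Matrix.mul_assoc,
    mul_eq_one_comm.1 (bmat_mul b), Matrix.one_mul]

theorem tr_eq (hu : Sm Ω u) (hΩ : IsOpen Ω) (hx : x ∈ Ω) 
    (b : OrthonormalBasis (Fin n) ℝ (EuclideanSpace ℝ (Fin n))) :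
    ∑ k, dd (b k) (dd (b k) u) x = ∑ i, hessian u x i i := by
  have := congrArg Matrix.trace (hess_eq hu hΩ hx b)
  rw [Matrix.trace_mul_comm, ← Matrix.mul_assoc,
    mul_eq_one_comm.1 (bmat_mul b), Matrix.one_mul] at this
  exact this

theorem eigenbasis (hu : Sm Ω u) (hΩ : IsOpen Ω) (hx : x ∈ Ω) :
    ∃ (b : OrthonormalBasis (Fin n) ℝ (EuclideanSpace ℝ (Fin n))) (l : Fin n → ℝ),
      ∀ i j, dd (b i) (dd (b j) u) x = if i = j then l j else 0 := by
  have hH : (hessian u x).IsHermitian := by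
    ext i j
    have h := dd_comm hu hΩ hx (EuclideanSpace.basisFun (Fin n) ℝ i) (EuclideanSpace.basisFun (Fin n) ℝ j)
    rw [dd_dd hu hΩ hx, dd_dd hu hΩ hx] at h
    simp only [Matrix.conjTranspose_apply, hessian, Matrix.of_apply, iteratedFDeriv_two_apply]
    simpa using h.symm
  refine ⟨hH.eigenvectorBasis, hH.eigenvalues, fun i j => ?_⟩
  rw [dd_quad hu hΩ hx, hH.mulVec_eigenvectorBasis, dotProduct_smul]
  have := (orthonormal_iff_ite.1 hH.eigenvectorBasis.orthonormal) j i
  rw [PiLp.inner_apply] at this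
  simp only [RCLike.inner_apply, conj_trivial] at this
  simp only [dotProduct, smul_eq_mul]
  rw [this]
  simp [eq_comm]

variable {G : ℝ → ℝ}

theorem pde1 (hu : Sm Ω u) (hΩ : IsOpen Ω) (hG : ContDiff ℝ (⊤ : ℕ∞) G)
    (heq : ∀ x ∈ Ω, ∑ i, hessian u x i i = G (u x))
    (b : OrthonormalBasis (Fin n) ℝ (EuclideanSpace ℝ (Fin n))) 
    (v : EuclideanSpace ℝ (Fin n)) : ∀ x ∈ Ω,
    ∑ k, dd (b k) (dd (b k) (dd v u)) x = deriv G (u x) * dd v u x := by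
  intro x hx
  rw [← dd_comp (hG.differentiable (by simp) _) (hu.da hΩ hx)]
  rw [dd_congr hΩ (g := fun y => ∑ k, dd (b k) (dd (b k) u) y)
    (fun y hy => by rw [← heq y hy, tr_eq hu hΩ hy b]) v hx]
  rw [dd_sum (fun k _ => ((hu.dd hΩ _).dd hΩ _).da hΩ hx)]
  refine Finset.sum_congr rfl fun k _ => ?_
  rw [dd_comm (hu.dd hΩ _) hΩ hx v]
  exact dd_congr hΩ (fun y hy => dd_comm hu hΩ hy _ _) _ hx

theorem pde2 (hu : Sm Ω u) (hΩ : IsOpen Ω) (hG : ContDiff ℝ (⊤ : ℕ∞) G)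
    (heq : ∀ x ∈ Ω, ∑ i, hessian u x i i = G (u x))
    (b : OrthonormalBasis (Fin n) ℝ (EuclideanSpace ℝ (Fin n))) 
    (v : EuclideanSpace ℝ (Fin n)) : ∀ x ∈ Ω,
    ∑ k, dd (b k) (dd (b k) (dd v (dd v u))) x
      = deriv G (u x) * dd v (dd v u) x + deriv (deriv G) (u x) * (dd v u x) ^ 2 := by
  intro x hx
  have hG' : ContDiff ℝ (⊤ : ℕ∞) (deriv G) := (contDiff_infty_iff_deriv.1 hG).2
  have h1 : dd v (fun y => deriv G (u y) * dd v u y) x =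
      deriv G (u x) * dd v (dd v u) x + deriv (deriv G) (u x) * (dd v u x) ^ 2 := by
    rw [dd_mul ((Sm.comp hG' hu).da hΩ hx) ((hu.dd hΩ v).da hΩ hx),
      dd_comp (hG'.differentiable (by simp) _) (hu.da hΩ hx)]
    ring
  rw [← h1, dd_congr hΩ (fun y hy => (pde1 hu hΩ hG heq b v y hy).symm) v hx]
  rw [dd_sum (fun k _ => (((hu.dd hΩ _).dd hΩ _).dd hΩ _).da hΩ hx)]
  refine Finset.sum_congr rfl fun k _ => ?_
  rw [dd_comm ((hu.dd hΩ _).dd hΩ _) hΩ hx v]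
  exact dd_congr hΩ (fun y hy => dd_comm (hu.dd hΩ _) hΩ hy _ _) _ hx
end Euc


theorem alg_k {n : ℕ} (hn : 2 ≤ n) (l b : Fin n → ℝ) (hl : ∀ i, 0 < l i) (k : Fin n)
    (g1 g2 w : ℝ) (hb : ∑ i, b i = 0) (hlb : ∑ i, l i * b i = g1 * w)
    (hg : (∑ i, l i) * g2 ≤ ((n : ℝ) / ((n : ℝ) - 1)) * g1 ^ 2) :
    g2 * w ^ 2 / l k ≤ ∑ i, b i ^ 2 + 2 * ∑ i, (if i = k then 0 else b i ^ 2 * l i / l k) := by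
  have hn' : (2 : ℝ) ≤ n := by exact_mod_cast hn
  obtain ⟨c, hc⟩ : ∃ c : ℝ, c = 1 / ((n : ℝ) - 1) := ⟨_, rfl⟩
  have hc1 : c * ((n : ℝ) - 1) = 1 := by rw [hc]; exact one_div_mul_cancel (by linarith)
  have hc0 : 0 < c := by rw [hc]; apply one_div_pos.2; linarith
  have hcle : c ≤ 1 := by nlinarith
  have hcn : (n : ℝ) / ((n : ℝ) - 1) = 1 + c := by
    rw [hc]; field_simp [show (n : ℝ) - 1 ≠ 0 by linarith]; ring
  rw [hcn] at hg
  have hsum : ∀ f : Fin n → ℝ, ∑ i, f i = f k + ∑ i ∈ Finset.univ.erase k, f i := fun f =>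
    (Finset.add_sum_erase _ _ (Finset.mem_univ k)).symm
  have hgpos : 0 < ∑ i, l i := by
    rw [hsum]; exact add_pos_of_pos_of_nonneg (hl k) (Finset.sum_nonneg fun i _ => (hl i).le)
  have hCS : (∑ i, l i * b i) ^ 2 ≤ (∑ i, l i) * ∑ i, l i * b i ^ 2 := by
    apply Finset.sum_sq_le_sum_mul_sum_of_sq_le_mul
    · intro i _; exact (hl i).le
    · intro i _; have := hl i; positivity
    · intro i _; apply le_of_eq; ring
  have h1 : g2 * w ^ 2 ≤ (1 + c) * ∑ i, l i * b i ^ 2 := by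
    have : (∑ i, l i) * (g2 * w ^ 2) ≤ (∑ i, l i) * ((1 + c) * ∑ i, l i * b i ^ 2) := by
      rw [hlb] at hCS
      calc (∑ i, l i) * (g2 * w ^ 2) = ((∑ i, l i) * g2) * w ^ 2 := by ring
        _ ≤ ((1 + c) * g1 ^ 2) * w ^ 2 := by gcongr
        _ = (1 + c) * (g1 * w) ^ 2 := by ring
        _ ≤ (1 + c) * ((∑ i, l i) * ∑ i, l i * b i ^ 2) := by gcongr
        _ = _ := by ring
    exact le_of_mul_le_mul_left this hgpos
  have hB : (b k) ^ 2 ≤ ((n : ℝ) - 1) * ∑ i ∈ Finset.univ.erase k, b i ^ 2 := by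
    have h2 := sq_sum_le_card_mul_sum_sq (s := Finset.univ.erase k) (f := b)
    rw [hsum] at hb
    have h3 : b k = - ∑ i ∈ Finset.univ.erase k, b i := by linarith
    rw [h3, neg_sq]
    refine h2.trans (le_of_eq ?_)
    rw [Finset.card_erase_of_mem (Finset.mem_univ k), Finset.card_univ, Fintype.card_fin,
      Nat.cast_sub (by omega)]
    simp
  have hR : ∑ i, (if i = k then 0 else b i ^ 2 * l i / l k)
      = (∑ i ∈ Finset.univ.erase k, l i * b i ^ 2) / l k := by
    rw [hsum, if_pos rfl, zero_add, Finset.sum_div]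
    refine Finset.sum_congr rfl fun i hi => ?_
    rw [if_neg (Finset.ne_of_mem_erase hi), mul_comm (l i)]
  rw [hR, hsum (fun i => b i ^ 2)]
  rw [hsum (fun i => l i * b i ^ 2)] at h1
  have hRn : 0 ≤ ∑ i ∈ Finset.univ.erase k, l i * b i ^ 2 :=
    Finset.sum_nonneg fun i _ => by have := hl i; positivity
  set Q := ∑ i ∈ Finset.univ.erase k, b i ^ 2
  set R := ∑ i ∈ Finset.univ.erase k, l i * b i ^ 2
  have hlk := hl k
  have h5 : c * b k ^ 2 ≤ Q := by
    calc c * b k ^ 2 ≤ c * (((n : ℝ) - 1) * Q) := by gcongr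
      _ = Q := by rw [← mul_assoc, hc1, one_mul]
  have h6 : l k * (c * b k ^ 2) ≤ l k * Q := by gcongr
  have h7 : c * R ≤ 1 * R := by gcongr
  rw [div_le_iff₀ hlk]
  have : (b k ^ 2 + Q + 2 * (R / l k)) * l k = l k * b k ^ 2 + l k * Q + 2 * R := by
    field_simp
  rw [this]
  nlinarith

theorem alg_tot {n : ℕ} (hn : 2 ≤ n) (l : Fin n → ℝ) (hl : ∀ i, 0 < l i) 
    (g1 g2 : ℝ) (w : Fin n → ℝ) (T : Fin n → Fin n → Fin n → ℝ)
    (hT1 : ∀ i j k, T i j k = T j i k) (hT2 : ∀ i j k, T i j k = T i k j)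
    (hb : ∀ k, ∑ i, T i i k / l i = 0) (hlb : ∀ k, ∑ i, T i i k = g1 * w k)
    (hg : (∑ i, l i) * g2 ≤ ((n : ℝ) / ((n : ℝ) - 1)) * g1 ^ 2) :
    g2 * ∑ k, w k ^ 2 / l k ≤ ∑ k, ∑ i, ∑ j, T i j k ^ 2 / (l i * l j) := by
  have h1 : ∀ k, g2 * w k ^ 2 / l k ≤ ∑ i, (T i i k / l i) ^ 2
      + 2 * ∑ i, (if i = k then 0 else (T i i k / l i) ^ 2 * l i / l k) := fun k =>
    alg_k hn l (fun i => T i i k / l i) hl k g1 g2 (w k) (hb k)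
      (by rw [← hlb k]; exact Finset.sum_congr rfl fun i _ => by
            have := (hl i).ne'; field_simp) hg
  have h2 : ∑ k, ∑ i, ∑ j, ((if i = j then T i j k ^ 2 / (l i * l j) else 0)
      + (if k = i then (if i = j then 0 else T i j k ^ 2 / (l i * l j)) else 0)
      + (if k = j then (if i = j then 0 else T i j k ^ 2 / (l i * l j)) else 0))
      ≤ ∑ k, ∑ i, ∑ j, T i j k ^ 2 / (l i * l j) := by
    refine Finset.sum_le_sum fun k _ => Finset.sum_le_sum fun i _ => Finset.sum_le_sum fun j _ => ?_
    have h3 : 0 ≤ T i j k ^ 2 / (l i * l j) := by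
      have := hl i; have := hl j; positivity
    split_ifs <;> simp_all
  refine le_trans ?_ h2
  simp only [Finset.sum_add_distrib]
  have e1 : ∑ k, ∑ i, ∑ j, (if i = j then T i j k ^ 2 / (l i * l j) else 0)
      = ∑ k, ∑ i, (T i i k / l i) ^ 2 := by
    simp [sq, div_mul_div_comm]
  have e2 : ∑ k, ∑ i, ∑ j, (if k = i then (if i = j then 0 else T i j k ^ 2 / (l i * l j)) else 0)
      = ∑ k, ∑ i, (if i = k then 0 else (T i i k / l i) ^ 2 * l i / l k) := by
    have : ∀ k, ∑ i, ∑ j, (if k = i then (if i = j then 0 else T i j k ^ 2 / (l i * l j)) else 0)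
        = ∑ j, (if k = j then 0 else T k j k ^ 2 / (l k * l j)) := by
      intro k; rw [Finset.sum_comm]; simp
    simp_rw [this]
    rw [Finset.sum_comm]
    refine Finset.sum_congr rfl fun k _ => Finset.sum_congr rfl fun i _ => ?_
    by_cases h : i = k
    · simp [h]
    · simp only [h, if_false]
      rw [hT2 i k i]
      have := (hl i).ne'; have := (hl k).ne'; field_simp
  have e3 : ∑ k, ∑ i, ∑ j, (if k = j then (if i = j then 0 else T i j k ^ 2 / (l i * l j)) else 0)
      = ∑ k, ∑ i, (if i = k then 0 else (T i i k / l i) ^ 2 * l i / l k) := by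
    have : ∀ k, ∑ i, ∑ j, (if k = j then (if i = j then 0 else T i j k ^ 2 / (l i * l j)) else 0)
        = ∑ i, (if i = k then 0 else T i k k ^ 2 / (l i * l k)) := by
      intro k; simp
    simp_rw [this]
    rw [Finset.sum_comm]
    refine Finset.sum_congr rfl fun k _ => Finset.sum_congr rfl fun i _ => ?_
    by_cases h : i = k
    · simp [h]
    · simp only [h, Ne.symm h, if_false]
      rw [hT1 k i i, hT2 i k i]
      have := (hl i).ne'; have := (hl k).ne'; field_simp
  rw [e1, e2, e3, ← Finset.sum_add_distrib, ← Finset.sum_add_distrib, Finset.mul_sum]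
  refine Finset.sum_le_sum fun k _ => ?_
  have := h1 k
  rw [mul_div_assoc] at this
  linarith

theorem pos_case {n : ℕ} (hn : 2 ≤ n)
    {Ω : Set (EuclideanSpace ℝ (Fin n))} (hΩ : IsOpen Ω)
    {G : ℝ → ℝ} (hG : ContDiff ℝ (⊤ : ℕ∞) G)
    (hG' : ∀ t, deriv G t < 0)
    (hGG'' : ∀ t, G t * deriv (deriv G) t ≤ ((n : ℝ) / ((n : ℝ) - 1)) * (deriv G t) ^ 2)
    {u : EuclideanSpace ℝ (Fin n) → ℝ} (hu : Sm Ω u)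
    (hconv : ∀ x ∈ Ω, (hessian u x).PosSemidef)
    (heq : ∀ x ∈ Ω, ∑ i, hessian u x i i = G (u x))
    {p : EuclideanSpace ℝ (Fin n)} (hp : p ∈ Ω)
    (hmin : IsLocalMin (fun x => (hessian u x).det) p) : (hessian u p).det = 0 := by
  by_contra hne
  obtain ⟨b, l, hbl⟩ := eigenbasis hu hΩ hp
  set A : EuclideanSpace ℝ (Fin n) → Matrix (Fin n) (Fin n) ℝ :=
    fun x => Matrix.of fun i j => dd (b i) (dd (b j) u) x with hA
  have hAs : ∀ i j, Sm Ω (fun x => A x i j) := fun i j => (hu.dd hΩ _).dd hΩ _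
  have hAd : ∀ i j, ∀ x ∈ Ω, DifferentiableAt ℝ (fun x => A x i j) x :=
    fun i j x hx => (hAs i j).da hΩ hx
  have hAp : ∀ i j, A p i j = if i = j then l j else 0 := hbl
  have hApd : A p = Matrix.diagonal l := by
    ext i j; rw [hAp, Matrix.diagonal_apply]; split_ifs with h <;> simp [h]
  have hmin' : IsLocalMin (fun x => (A x).det) p := by
    filter_upwards [hmin, hΩ.mem_nhds hp] with x hx hxΩ
    simp only [hA]
    rw [det_eq hu hΩ hxΩ, det_eq hu hΩ hp]; exact hx
  have hP : (A p).det ≠ 0 := by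
    simp only [hA]; rw [det_eq hu hΩ hp]; exact hne
  have hl0 : ∀ i, l i ≠ 0 := by
    rw [hApd, Matrix.det_diagonal] at hP
    exact fun i => Finset.prod_ne_zero_iff.1 hP i (Finset.mem_univ i)
  have hl : ∀ i, 0 < l i := by
    intro i
    refine lt_of_le_of_ne ?_ (hl0 i).symm
    have h := hbl i i
    rw [if_pos rfl, dd_quad hu hΩ hp] at h
    rw [← h]
    simpa using (hconv p hp).dotProduct_mulVec_nonneg (b i).ofLp
  set P := (A p).det with hPdef
  have hPpos : 0 < P := by
    rw [hPdef, hApd, Matrix.det_diagonal]; exact Finset.prod_pos fun i _ => hl i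
  have hadj : ∀ i j, (A p).adjugate i j = if i = j then P / l i else 0 := by
    intro i j
    have h := congrFun (congrFun (Matrix.mul_adjugate (A p)) i) j
    rw [hApd, Matrix.diagonal_mul, ← hApd, Matrix.smul_apply, Matrix.one_apply, ← hPdef] at h
    have := hl0 i
    split_ifs at h ⊢ with hij
    · rw [eq_div_iff this, mul_comm]; simpa using h
    · simpa [this] using h
  set T : Fin n → Fin n → Fin n → ℝ := fun i j k => dd (b k) (dd (b i) (dd (b j) u)) p with hT
  have hT1 : ∀ i j k, T i j k = T j i k := fun i j k =>
    dd_congr hΩ (fun y hy => dd_comm hu hΩ hy _ _) _ hp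
  have hT2 : ∀ i j k, T i j k = T i k j := by
    intro i j k
    rw [hT1 i j k, hT1 i k j]
    exact dd_comm (hu.dd hΩ _) hΩ hp _ _
  have hAT : ∀ i j k, dd (b k) (fun x => A x i j) p = T i j k := fun i j k => rfl
  have hadjs : ∀ i j, Sm Ω (fun x => (A x).adjugate i j) := Sm.adj hAs
  have hDs : Sm Ω (fun x => (A x).det) := Sm.det hAs
  have htest := fun k => localMin_test hDs hΩ hp hmin' (b k)
  have hdD : ∀ k, ∀ x ∈ Ω, dd (b k) (fun x => (A x).det) x =
      ∑ i, ∑ j, (A x).adjugate i j * dd (b k) (fun x => A x j i) x :=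
    fun k x hx => dd_det (fun i j => hAd i j x hx) (b k)
  have hfirst : ∀ k, ∑ i, T i i k / l i = 0 := by
    intro k
    have h := (htest k).1
    rw [hdD k p hp] at h
    simp only [hadj, hAT, ite_mul, zero_mul, Finset.sum_ite_eq, Finset.mem_univ, if_true] at h
    have h2 : P * ∑ i, T i i k / l i = 0 := by
      rw [← h, Finset.mul_sum]; exact Finset.sum_congr rfl fun i _ => by ring
    exact (mul_eq_zero.1 h2).resolve_left hP
  have hdadj : ∀ i j k, dd (b k) (fun x => (A x).adjugate i j) p = - P * T i j k / (l i * l j) := by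
    intro i j k
    have h0 : dd (b k) (fun x => ∑ m, A x i m * (A x).adjugate m j) p = 0 := by
      have : ∀ y ∈ Ω, ∑ m, A y i m * (A y).adjugate m j
          = (if i = j then (1:ℝ) else 0) * (A y).det := by
        intro y hy
        have h := congrFun (congrFun (Matrix.mul_adjugate (A y)) i) j
        rw [Matrix.mul_apply, Matrix.smul_apply, Matrix.one_apply] at h
        rw [h, smul_eq_mul, mul_comm]
      rw [dd_congr hΩ this _ hp, dd_const_mul _ (hDs.da hΩ hp), (htest k).1, mul_zero]
    rw [dd_sum (fun m _ => ((hAs i m).mul (hadjs m j)).da hΩ hp)] at h0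
    simp_rw [dd_mul (hAd i _ p hp) ((hadjs _ j).da hΩ hp)] at h0
    simp only [hAT, hadj, hAp, Finset.sum_add_distrib, ite_mul, zero_mul, mul_ite, mul_zero,
      Finset.sum_ite_eq, Finset.sum_ite_eq', Finset.mem_univ, if_true] at h0
    have h1 := hl0 i
    have h2 := hl0 j
    field_simp at h0 ⊢
    linarith
  have hsecond : ∀ k, 0 ≤ ∑ i, dd (b k) (dd (b k) (dd (b i) (dd (b i) u))) p / l i
      - ∑ i, ∑ j, T i j k ^ 2 / (l i * l j) := by
    intro k
    have h := (htest k).2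
    rw [dd_congr hΩ (hdD k) _ hp] at h
    have hs : ∀ i j, Sm Ω (fun x => (A x).adjugate i j * dd (b k) (fun x => A x j i) x) :=
      fun i j => (hadjs i j).mul ((hAs j i).dd hΩ _)
    rw [dd_sum (fun i _ => (Sm.sum fun j _ => hs i j).da hΩ hp)] at h
    simp_rw [dd_sum (fun j _ => (hs _ j).da hΩ hp),
      dd_mul ((hadjs _ _).da hΩ hp) (((hAs _ _).dd hΩ _).da hΩ hp)] at h
    simp only [hAT, hadj, hdadj, Finset.sum_add_distrib, ite_mul, zero_mul,
      Finset.sum_ite_eq, Finset.mem_univ, if_true] at h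
    have h3 : 0 ≤ P * (∑ i, dd (b k) (dd (b k) (dd (b i) (dd (b i) u))) p / l i
      - ∑ i, ∑ j, T i j k ^ 2 / (l i * l j)) := by
      refine h.trans (le_of_eq ?_)
      rw [mul_sub, Finset.mul_sum, Finset.mul_sum, sub_eq_add_neg, ← Finset.sum_neg_distrib]
      congr 1
      · refine Finset.sum_congr rfl fun i _ => ?_
        have : dd (b k) (dd (b k) fun x => A x i i) p
          = dd (b k) (dd (b k) (dd (b i) (dd (b i) u))) p := rfl
        rw [this]; ring
      · refine Finset.sum_congr rfl fun i _ => ?_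
        rw [Finset.mul_sum, ← Finset.sum_neg_distrib]
        refine Finset.sum_congr rfl fun j _ => ?_
        rw [hT1 j i k]; ring
    exact nonneg_of_mul_nonneg_right h3 hPpos
  have hsum := Finset.sum_nonneg fun k (_ : k ∈ Finset.univ) => hsecond k
  rw [Finset.sum_sub_distrib, Finset.sum_comm] at hsum
  simp_rw [← Finset.sum_div, pde2 hu hΩ hG heq b _ p hp] at hsum
  have hx1 : ∑ i, (deriv G (u p) * dd (b i) (dd (b i) u) p
      + deriv (deriv G) (u p) * dd (b i) u p ^ 2) / l i
      = n * deriv G (u p) + deriv (deriv G) (u p) * ∑ i, dd (b i) u p ^ 2 / l i := by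
    rw [Finset.mul_sum]
    have : (n : ℝ) * deriv G (u p) = ∑ i : Fin n, deriv G (u p) := by simp
    rw [this, ← Finset.sum_add_distrib]
    refine Finset.sum_congr rfl fun i _ => ?_
    rw [hbl i i, if_pos rfl]
    have := hl0 i
    field_simp
  rw [hx1] at hsum
  have htr : ∑ i, l i = G (u p) := by
    rw [← heq p hp, ← tr_eq hu hΩ hp b]
    exact Finset.sum_congr rfl fun i _ => by rw [hbl i i, if_pos rfl]
  have halg := alg_tot hn l hl (deriv G (u p)) (deriv (deriv G) (u p)) (fun k => dd (b k) u p) T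
    hT1 hT2 hfirst (fun k => by
      rw [← pde1 hu hΩ hG heq b (b k) p hp]
      refine Finset.sum_congr rfl fun i _ => ?_
      rw [hT2 i i k]) (by rw [htr]; exact hGG'' _)
  have hneg := hG' (u p)
  have hn' : (2 : ℝ) ≤ n := by exact_mod_cast hn
  nlinarith


theorem tau_dd {E : Type*} [NormedAddCommGroup E] [NormedSpace ℝ E] {Ω : Set E} (hΩ : IsOpen Ω)
    {t q f : E → ℝ} {v z : E} (hz : z ∈ Ω) (ht : Sm Ω t) (hq : Sm Ω q) (hf : Sm Ω f)
    (ht1 : ∀ x, dd v t x = 1) (ht0 : t z = 0) :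
    dd v (fun x => f x + t x * q x) z = dd v f z + q z ∧
    dd v (dd v (fun x => f x + t x * q x)) z = dd v (dd v f) z + 2 * dd v q z := by
  have h1 : ∀ x ∈ Ω, dd v (fun x => f x + t x * q x) x
      = dd v f x + (t x * dd v q x + q x) := by
    intro x hx
    rw [dd_add (hf.da hΩ hx) ((ht.mul hq).da hΩ hx), dd_mul (ht.da hΩ hx) (hq.da hΩ hx), ht1, one_mul]
  refine ⟨by rw [h1 z hz, ht0]; ring, ?_⟩
  rw [dd_congr hΩ h1 v hz]
  have hq' := hq.dd hΩ v
  rw [dd_add ((hf.dd hΩ v).da hΩ hz) (((ht.mul hq').add hq).da hΩ hz),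
    dd_add ((ht.mul hq').da hΩ hz) (hq.da hΩ hz), dd_mul (ht.da hΩ hz) (hq'.da hΩ hz), ht1, ht0]
  ring

theorem dd_lin {n : ℕ} {Ω : Set (EuclideanSpace ℝ (Fin n))} (hΩ : IsOpen Ω)
    {u : EuclideanSpace ℝ (Fin n) → ℝ} (hu : Sm Ω u) {x : EuclideanSpace ℝ (Fin n)} (hx : x ∈ Ω)
    (v w : EuclideanSpace ℝ (Fin n)) (c : ℝ) :
    dd (v + c • w) (dd (v + c • w) u) x
      = dd v (dd v u) x + 2 * c * dd v (dd w u) x + c ^ 2 * dd w (dd w u) x := by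
  have h := dd_comm hu hΩ hx v w
  simp only [dd_dd hu hΩ hx] at h ⊢
  simp only [map_add, map_smul, add_apply, smul_apply,
    smul_eq_mul]
  rw [← h]; ring

theorem key {n : ℕ} (hn : 2 ≤ n)
    {Ω : Set (EuclideanSpace ℝ (Fin n))} (hΩ : IsOpen Ω)
    {G : ℝ → ℝ} (hG : ContDiff ℝ (⊤ : ℕ∞) G) (hGpos : ∀ t, 0 < G t)
    (hG' : ∀ t, deriv G t < 0)
    (hGG'' : ∀ t, G t * deriv (deriv G) t ≤ ((n : ℝ) / ((n : ℝ) - 1)) * (deriv G t) ^ 2)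
    {u : EuclideanSpace ℝ (Fin n) → ℝ} (hu : Sm Ω u)
    (heq : ∀ x ∈ Ω, ∑ i, hessian u x i i = G (u x))
    {z : EuclideanSpace ℝ (Fin n)} (hz : z ∈ Ω)
    {ψ : EuclideanSpace ℝ (Fin n) → ℝ} (hψ : Sm Ω ψ)
    (hlow : ∀ᶠ x in nhds z, ∀ ξ, ψ x * ‖ξ‖ ^ 2 ≤ dd ξ (dd ξ u) x)
    {ξ₀ : EuclideanSpace ℝ (Fin n)} (hξ₀ : ξ₀ ≠ 0) (hξ₀' : dd ξ₀ (dd ξ₀ u) z = ψ z * ‖ξ₀‖ ^ 2)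
    (h0 : 0 ≤ ψ z) :
    ∃ (b : OrthonormalBasis (Fin n) ℝ (EuclideanSpace ℝ (Fin n))) (i : Fin n),
      (∑ k, dd (b k) (dd (b k) ψ) z) * G (u z)
        ≤ 4 * n * |deriv G (u z)| * |dd (b i) u z| * |dd (b i) ψ z| := by
  obtain ⟨b, l, hbl⟩ := eigenbasis hu hΩ hz
  have hnorm : ∀ i, ‖b i‖ = 1 := fun i => b.orthonormal.1 i
  have hlz := hlow.self_of_nhds
  have hμ : ∀ i, 0 ≤ l i - ψ z := by
    intro i
    have := hlz (b i)
    rw [hnorm, hbl i i, if_pos rfl] at this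
    linarith
  obtain ⟨i₀, hi₀⟩ : ∃ i, l i = ψ z := by
    have hexp : dd ξ₀ (dd ξ₀ u) z = ∑ i, (b.repr ξ₀ i) ^ 2 * l i := by
      conv_lhs => rw [← b.sum_repr ξ₀]
      rw [dd_dd hu hΩ hz]
      simp only [map_sum, map_smul]
      simp only [sum_apply, smul_apply, smul_eq_mul,
        ← dd_dd hu hΩ hz, hbl]
      refine Finset.sum_congr rfl fun i _ => ?_
      simp
      ring
    have hnm : ‖ξ₀‖ ^ 2 = ∑ i, (b.repr ξ₀ i) ^ 2 := by
      rw [← b.repr.norm_map, EuclideanSpace.norm_sq_eq]; simp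
    have hs : ∑ i, (b.repr ξ₀ i) ^ 2 * (l i - ψ z) = 0 := by
      simp only [mul_sub, Finset.sum_sub_distrib, ← Finset.sum_mul]
      rw [← hnm, ← hexp, hξ₀']; ring
    rw [Finset.sum_eq_zero_iff_of_nonneg (fun i _ => mul_nonneg (sq_nonneg _) (hμ i))] at hs
    have : ∃ i, b.repr ξ₀ i ≠ 0 := by
      by_contra hcon
      push Not at hcon
      apply hξ₀
      rw [← b.sum_repr ξ₀]
      simp [hcon]
    obtain ⟨i, hi⟩ := this
    refine ⟨i, ?_⟩
    have := hs i (Finset.mem_univ i)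
    have h2 := (mul_eq_zero.1 this).resolve_left (pow_ne_zero 2 hi)
    linarith
  refine ⟨b, i₀, ?_⟩
  have hHs : ∀ i j, Sm Ω (dd (b i) (dd (b j) u)) := fun i j => (hu.dd hΩ _).dd hΩ _
  have hNs : ∀ i, Sm Ω (fun x => dd (b i) (dd (b i) u) x - ψ x) := fun i => (hHs i i).sub hψ
  have hddN : ∀ i k, dd (b k) (dd (b k) (fun x => dd (b i) (dd (b i) u) x - ψ x)) z
      = dd (b k) (dd (b k) (dd (b i) (dd (b i) u))) z - dd (b k) (dd (b k) ψ) z := by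
    intro i k
    rw [dd_congr hΩ (fun y hy => dd_sub ((hHs i i).da hΩ hy) (hψ.da hΩ hy) _) _ hz,
      dd_sub (((hHs i i).dd hΩ _).da hΩ hz) ((hψ.dd hΩ _).da hΩ hz)]
  -- local minimum of the diagonal entries in the kernel
  have hKmin : ∀ i, l i = ψ z → IsLocalMin (fun x => dd (b i) (dd (b i) u) x - ψ x) z := by
    intro i hi
    filter_upwards [hlow] with x hx
    have := hx (b i)
    rw [hnorm] at this
    rw [hbl i i, if_pos rfl, hi]
    linarith
  have hK1 : ∀ i, l i = ψ z → dd (b i₀) (dd (b i) (dd (b i) u)) z = dd (b i₀) ψ z := by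
    intro i hi
    have := (localMin_test (hNs i) hΩ hz (hKmin i hi) (b i₀)).1
    rw [dd_sub ((hHs i i).da hΩ hz) (hψ.da hΩ hz)] at this
    linarith
  have hK2 : ∀ k, 0 ≤ dd (b k) (dd (b k) (dd (b i₀) (dd (b i₀) u))) z - dd (b k) (dd (b k) ψ) z := by
    intro k
    rw [← hddN]
    exact (localMin_test (hNs i₀) hΩ hz (hKmin i₀ hi₀) (b k)).2
  set a : Fin n → ℝ := fun k => dd (b i₀) (dd (b k) (dd (b k) u)) z with ha
  have hR : ∀ k, l k ≠ ψ z → 2 * (a k ^ 2 / (l k - ψ z)) ≤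
      dd (b k) (dd (b k) (dd (b i₀) (dd (b i₀) u))) z - dd (b k) (dd (b k) ψ) z := by
    intro k hk
    have hki : k ≠ i₀ := fun h => hk (h ▸ hi₀)
    have hμk : 0 < l k - ψ z := lt_of_le_of_ne (hμ k) (fun h => hk (by linarith))
    set s : ℝ := - a k / (l k - ψ z) with hs
    set t : EuclideanSpace ℝ (Fin n) → ℝ := fun x => inner ℝ (b k) (x - z) with ht
    have hts : ContDiff ℝ (⊤ : ℕ∞) t := by
      exact contDiff_const.inner ℝ (contDiff_id.sub contDiff_const)
    have htS : Sm Ω t := hts.contDiffOn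
    have ht1 : ∀ x, dd (b k) t x = 1 := by
      intro x
      have h1 : HasFDerivAt t (innerSL ℝ (b k)) x := by
        have := (innerSL ℝ (b k)).hasFDerivAt.comp x ((hasFDerivAt_id x).sub_const z)
        exact this
      unfold dd
      rw [h1.fderiv]; simp
    have ht0 : t z = 0 := by simp [ht]
    set q : EuclideanSpace ℝ (Fin n) → ℝ := fun x => 2 * s * dd (b i₀) (dd (b k) u) x
      + t x * (s ^ 2 * (dd (b k) (dd (b k) u) x - ψ x)) with hq
    have hq2 : Sm Ω (fun x => s ^ 2 * (dd (b k) (dd (b k) u) x - ψ x)) :=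
      (Sm.const _).mul (hNs k)
    have hq1 : Sm Ω (fun x => 2 * s * dd (b i₀) (dd (b k) u) x) := (Sm.const _).mul (hHs i₀ k)
    have hqs : Sm Ω q := hq1.add (htS.mul hq2)
    have hlm : IsLocalMin (fun x => (dd (b i₀) (dd (b i₀) u) x - ψ x) + t x * q x) z := by
      filter_upwards [hlow, hΩ.mem_nhds hz] with x hx hxΩ
      have h1 := hx (b i₀ + (s * t x) • b k)
      rw [dd_lin hΩ hu hxΩ] at h1
      have h2 : ‖b i₀ + (s * t x) • b k‖ ^ 2 = 1 + (s * t x) ^ 2 := by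
        rw [norm_add_sq_real, inner_smul_right, b.orthonormal.2 hki.symm, norm_smul, hnorm, hnorm]
        simp [mul_pow]
      rw [h2] at h1
      rw [ht0, hbl i₀ i₀, if_pos rfl, hi₀]
      simp only [hq]
      linarith
    have htest := (localMin_test ((hNs i₀).add (htS.mul hqs)) hΩ hz hlm (b k)).2
    rw [(tau_dd hΩ hz htS hqs (hNs i₀) ht1 ht0).2, (tau_dd hΩ hz htS hq2 hq1 ht1 ht0).1, hddN,
      dd_const_mul _ ((hHs i₀ k).da hΩ hz), hbl k k, if_pos rfl] at htest
    have hak : dd (b k) (dd (b i₀) (dd (b k) u)) z = a k :=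
      dd_comm (hu.dd hΩ _) hΩ hz _ _
    rw [hak] at htest
    have h5 : 2 * (2 * s * a k + s ^ 2 * (l k - ψ z)) = - (2 * (a k ^ 2 / (l k - ψ z))) := by
      rw [hs]; field_simp; ring
    linarith
  -- sum up
  have hR' : ∀ k, 2 * (a k ^ 2 / (l k - ψ z)) ≤
      dd (b k) (dd (b k) (dd (b i₀) (dd (b i₀) u))) z - dd (b k) (dd (b k) ψ) z := by
    intro k
    by_cases hk : l k = ψ z
    · rw [hk]; simpa using hK2 k
    · exact hR k hk
  have hsum := Finset.sum_le_sum fun k (_ : k ∈ Finset.univ) => hR' k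
  rw [Finset.sum_sub_distrib, pde2 hu hΩ hG heq b _ z hz, hbl i₀ i₀, if_pos rfl, hi₀,
    ← Finset.mul_sum] at hsum
  have htr : ∑ i, l i = G (u z) := by
    rw [← heq z hz, ← tr_eq hu hΩ hz b]
    exact Finset.sum_congr rfl fun i _ => by rw [hbl i i, if_pos rfl]
  have hta : ∑ k, a k = deriv G (u z) * dd (b i₀) u z := by
    rw [← pde1 hu hΩ hG heq b (b i₀) z hz]
    refine Finset.sum_congr rfl fun k _ => ?_
    rw [ha]
    simp only []
    rw [dd_comm (hu.dd hΩ _) hΩ hz]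
    exact dd_congr hΩ (fun y hy => dd_comm hu hΩ hy _ _) _ hz
  classical
  set K : Finset (Fin n) := Finset.univ.filter (fun k => l k = ψ z) with hK
  set K' : Finset (Fin n) := Finset.univ.filter (fun k => ¬ l k = ψ z) with hK'
  have hsplit : ∑ k ∈ K, a k + ∑ k ∈ K', a k = ∑ k, a k :=
    Finset.sum_filter_add_sum_filter_not _ _ _
  have hKs : ∑ k ∈ K, a k = K.card * dd (b i₀) ψ z := by
    have : ∑ k ∈ K, a k = ∑ k ∈ K, dd (b i₀) ψ z :=
      Finset.sum_congr rfl (fun k hk => hK1 k (Finset.mem_filter.1 hk).2)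
    rw [this]; simp
  have hcard : (K.card : ℝ) ≤ n := by
    have := Finset.card_le_univ K
    rw [Fintype.card_fin] at this
    exact_mod_cast this
  have hCS : (∑ k ∈ K', a k) ^ 2 ≤ (∑ k ∈ K', a k ^ 2 / (l k - ψ z)) * ∑ k ∈ K', (l k - ψ z) := by
    apply Finset.sum_sq_le_sum_mul_sum_of_sq_le_mul
    · intro i _; exact div_nonneg (sq_nonneg _) (hμ i)
    · intro i _; exact hμ i
    · intro i hi
      have : l i - ψ z ≠ 0 := fun h => (Finset.mem_filter.1 hi).2 (by linarith)
      rw [div_mul_cancel₀ _ this]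
  have hS1 : ∑ k ∈ K', a k ^ 2 / (l k - ψ z) ≤ ∑ k, a k ^ 2 / (l k - ψ z) :=
    Finset.sum_le_sum_of_subset_of_nonneg (Finset.subset_univ _)
      (fun i _ _ => div_nonneg (sq_nonneg _) (hμ i))
  have hS2 : ∑ k ∈ K', (l k - ψ z) ≤ G (u z) := by
    rw [← htr]
    calc ∑ k ∈ K', (l k - ψ z) ≤ ∑ k, (l k - ψ z) :=
          Finset.sum_le_sum_of_subset_of_nonneg (Finset.subset_univ _) (fun i _ _ => hμ i)
      _ ≤ ∑ k, l k := Finset.sum_le_sum fun k _ => by linarith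
  have hS0 : 0 ≤ ∑ k, a k ^ 2 / (l k - ψ z) :=
    Finset.sum_nonneg fun i _ => div_nonneg (sq_nonneg _) (hμ i)
  have hS3 : 0 ≤ ∑ k ∈ K', (l k - ψ z) := Finset.sum_nonneg fun i _ => hμ i
  have hCS' : (deriv G (u z) * dd (b i₀) u z - K.card * dd (b i₀) ψ z) ^ 2
      ≤ (∑ k, a k ^ 2 / (l k - ψ z)) * G (u z) := by
    have : ∑ k ∈ K', a k = deriv G (u z) * dd (b i₀) u z - K.card * dd (b i₀) ψ z := by
      rw [← hta, ← hsplit, hKs]; ring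
    rw [← this]
    exact hCS.trans (mul_le_mul hS1 hS2 hS3 hS0)
  have hn' : (2 : ℝ) ≤ n := by exact_mod_cast hn
  have hg2 : G (u z) * deriv (deriv G) (u z) ≤ 2 * (deriv G (u z)) ^ 2 := by
    refine (hGG'' (u z)).trans ?_
    gcongr
    rw [div_le_iff₀ (by linarith)]; linarith
  have hgp := hGpos (u z)
  have hgn := hG' (u z)
  set S := ∑ k, a k ^ 2 / (l k - ψ z)
  set L := ∑ k, dd (b k) (dd (b k) ψ) z
  set g := G (u z)
  set g1 := deriv G (u z)
  set g2 := deriv (deriv G) (u z)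
  set w := dd (b i₀) u z
  set d := dd (b i₀) ψ z
  set m : ℝ := (K.card : ℝ)
  have hm0 : 0 ≤ m := Nat.cast_nonneg _
  have habs : 4 * m * (g1 * w * d) ≤ 4 * n * |g1| * |w| * |d| := by
    calc 4 * m * (g1 * w * d) ≤ 4 * m * |g1 * w * d| := by gcongr; exact le_abs_self _
      _ ≤ 4 * n * |g1 * w * d| := by gcongr
      _ = _ := by rw [abs_mul, abs_mul]; ring
  have e1 : L * g ≤ (g1 * ψ z + g2 * w ^ 2 - 2 * S) * g := by
    apply mul_le_mul_of_nonneg_right _ hgp.le; linarith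
  have e2 : g1 * ψ z * g ≤ 0 :=
    mul_nonpos_of_nonpos_of_nonneg (mul_nonpos_of_nonpos_of_nonneg hgn.le h0) hgp.le
  have e3 : g * g2 * w ^ 2 ≤ 2 * g1 ^ 2 * w ^ 2 := by gcongr
  nlinarith [sq_nonneg (m * d)]


section Barrier
variable {E : Type*} [NormedAddCommGroup E] [InnerProductSpace ℝ E]

noncomputable def bar (α ε m : ℝ) (y : E) : E → ℝ :=
  fun x => ε * Real.exp (-α * ‖x - y‖ ^ 2) + m

theorem bar_contDiff (α ε m : ℝ) (y : E) : ContDiff ℝ (⊤ : ℕ∞) (bar α ε m y) := by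
  unfold bar
  have : ContDiff ℝ (⊤ : ℕ∞) (fun x : E => ‖x - y‖ ^ 2) :=
    (contDiff_id.sub contDiff_const).norm_sq ℝ
  exact (contDiff_const.mul (Real.contDiff_exp.comp (contDiff_const.mul this))).add contDiff_const

theorem bar_dd (α ε m : ℝ) (y v x : E) : dd v (bar α ε m y) x =
    (-2 * α * ε) * (inner ℝ (x - y) v * Real.exp (-α * ‖x - y‖ ^ 2)) := by
  have h1 : HasFDerivAt (fun x : E => ‖x - y‖ ^ 2) (2 • (innerSL ℝ (x - y))) x := by
    have := ((hasFDerivAt_id x).sub_const y).norm_sq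
    simpa using this
  have h2 := (((h1.const_mul (-α)).exp).const_mul ε).add_const m
  unfold dd bar
  rw [h2.fderiv]
  simp [inner_sub_left]
  ring

theorem bar_dd2 (α ε m : ℝ) (y v x : E) : dd v (dd v (bar α ε m y)) x =
    ε * (4 * α ^ 2 * (inner ℝ (x - y) v) ^ 2 - 2 * α * ‖v‖ ^ 2)
      * Real.exp (-α * ‖x - y‖ ^ 2) := by
  have h0 : dd v (bar α ε m y) = fun x => (-2 * α * ε) * (inner ℝ (x - y) v * bar α 1 0 y x) := by
    ext x; rw [bar_dd]; simp [bar]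
  have hi : HasFDerivAt (fun x : E => (inner ℝ (x - y) v : ℝ)) (innerSL ℝ v) x := by
    have := (innerSL ℝ v).hasFDerivAt.comp x ((hasFDerivAt_id x).sub_const y)
    refine this.congr_of_eventuallyEq (Filter.Eventually.of_forall fun z => ?_)
    simp [real_inner_comm]
  have hb : DifferentiableAt ℝ (bar α 1 0 y) x :=
    (bar_contDiff α 1 0 y).differentiable (by simp) x
  rw [h0, dd_const_mul _ (hi.differentiableAt.fun_mul hb), dd_mul hi.differentiableAt hb, bar_dd]
  have : dd v (fun x : E => (inner ℝ (x - y) v : ℝ)) x = ‖v‖ ^ 2 := by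
    unfold dd; rw [hi.fderiv]; simp
  rw [this]
  simp only [bar]
  ring
end Barrier

section Zero
variable {n : ℕ} {Ω : Set (EuclideanSpace ℝ (Fin n))} {u : EuclideanSpace ℝ (Fin n) → ℝ}

theorem det_zero_iff (hΩ : IsOpen Ω) (hu : Sm Ω u) (hconv : ∀ x ∈ Ω, (hessian u x).PosSemidef)
    {x : EuclideanSpace ℝ (Fin n)} (hx : x ∈ Ω) :
    (hessian u x).det = 0 ↔ ∃ ξ : EuclideanSpace ℝ (Fin n), ‖ξ‖ = 1 ∧ dd ξ (dd ξ u) x = 0 := by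
  constructor
  · intro h
    obtain ⟨v, hv, hv0⟩ := Matrix.exists_mulVec_eq_zero_iff.2 h
    set w : EuclideanSpace ℝ (Fin n) := WithLp.toLp 2 v with hw
    have hw0 : w ≠ 0 := by
      intro h; apply hv; have := congrArg WithLp.ofLp h; simpa [hw] using this
    refine ⟨(‖w‖⁻¹ : ℝ) • w, ?_, ?_⟩
    · rw [norm_smul, norm_inv, norm_norm, inv_mul_cancel₀ (norm_ne_zero_iff.2 hw0)]
    · rw [dd_quad hu hΩ hx]
      simp [hw, Matrix.mulVec_smul, hv0]
  · rintro ⟨ξ, h1, h2⟩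
    rw [dd_quad hu hΩ hx] at h2
    have h3 := ((hconv x hx).dotProduct_mulVec_zero_iff ξ.ofLp).1 (by simpa using h2)
    refine Matrix.exists_mulVec_eq_zero_iff.1 ⟨ξ.ofLp, ?_, h3⟩
    intro h
    have : ξ = 0 := by ext i; simp [h]
    rw [this] at h1; simp at h1

theorem dd_nonneg (hΩ : IsOpen Ω) (hu : Sm Ω u) (hconv : ∀ x ∈ Ω, (hessian u x).PosSemidef)
    {x : EuclideanSpace ℝ (Fin n)} (hx : x ∈ Ω) (ξ : EuclideanSpace ℝ (Fin n)) :
    0 ≤ dd ξ (dd ξ u) x := by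
  rw [dd_quad hu hΩ hx]
  simpa using (hconv x hx).dotProduct_mulVec_nonneg ξ.ofLp

theorem no_touch (hn : 2 ≤ n) (hΩ : IsOpen Ω)
    {G : ℝ → ℝ} (hG : ContDiff ℝ (⊤ : ℕ∞) G) (hGpos : ∀ t, 0 < G t)
    (hG' : ∀ t, deriv G t < 0)
    (hGG'' : ∀ t, G t * deriv (deriv G) t ≤ ((n : ℝ) / ((n : ℝ) - 1)) * (deriv G t) ^ 2)
    (hu : Sm Ω u)
    (hconv : ∀ x ∈ Ω, (hessian u x).PosSemidef)
    (heq : ∀ x ∈ Ω, ∑ i, hessian u x i i = G (u x))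
    {x₀ y : EuclideanSpace ℝ (Fin n)} {R : ℝ} (hR : 0 < R) (hxy : ‖x₀ - y‖ = R)
    (hsub : Metric.closedBall x₀ (R / 2) ⊆ Ω) (hx₀ : (hessian u x₀).det = 0)
    (hfree : ∀ x ∈ Metric.closedBall y R, x ≠ x₀ → x ∈ Ω → (hessian u x).det ≠ 0) : False := by
  have hx₀Ω : x₀ ∈ Ω := hsub (Metric.mem_closedBall_self (by positivity))
  have hf1 : ContDiffOn ℝ (⊤ : ℕ∞) (fderiv ℝ u) Ω :=
    ContDiffOn.fderiv_of_isOpen hu hΩ (by exact_mod_cast le_rfl)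
  have hf2 : ContDiffOn ℝ (⊤ : ℕ∞) (fderiv ℝ (fderiv ℝ u)) Ω :=
    ContDiffOn.fderiv_of_isOpen hf1 hΩ (by exact_mod_cast le_rfl)
  have hGd : Continuous (deriv G) := hG.continuous_deriv (by simp)
  -- the constant
  obtain ⟨C, hC⟩ : ∃ C : ℝ, ∀ x ∈ Metric.closedBall x₀ (R / 2),
      ‖4 * n * |deriv G (u x)| * ‖fderiv ℝ u x‖ / G (u x)‖ ≤ C := by
    apply (isCompact_closedBall x₀ (R / 2)).exists_bound_of_continuousOn
    have hu' : ContinuousOn u (Metric.closedBall x₀ (R / 2)) :=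
      (ContDiffOn.continuousOn hu).mono hsub
    have hf1' := hf1.continuousOn.mono hsub
    refine ContinuousOn.div ?_ (hG.continuous.comp_continuousOn hu') (fun x _ => (hGpos _).ne')
    exact (continuousOn_const.mul (hGd.comp_continuousOn hu').abs).mul hf1'.norm
  have hC0 : 0 ≤ C := (norm_nonneg _).trans (hC x₀ (Metric.mem_closedBall_self (by positivity)))
  obtain ⟨α, hα⟩ : ∃ α : ℝ, α = 4 * n / R ^ 2 + 2 * C / R + 1 := ⟨_, rfl⟩
  have hα0 : 0 < α := by rw [hα]; positivity
  set S : Set (EuclideanSpace ℝ (Fin n)) := Metric.sphere 0 1 with hS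
  have hScomp : IsCompact S := isCompact_sphere _ _
  set Q : EuclideanSpace ℝ (Fin n) × EuclideanSpace ℝ (Fin n) → ℝ :=
    fun z => fderiv ℝ (fderiv ℝ u) z.1 z.2 z.2 with hQ
  have hQdd : ∀ x ∈ Ω, ∀ ξ, Q (x, ξ) = dd ξ (dd ξ u) x := fun x hx ξ => (dd_dd hu hΩ hx ξ ξ).symm
  have hQc : ContinuousOn Q (Ω ×ˢ Set.univ) := by
    have h1 : ContinuousOn (fun z : EuclideanSpace ℝ (Fin n) × EuclideanSpace ℝ (Fin n) =>
        fderiv ℝ (fderiv ℝ u) z.1) (Ω ×ˢ Set.univ) :=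
      hf2.continuousOn.comp continuousOn_fst (fun z hz => hz.1)
    exact (h1.clm_apply continuousOn_snd).clm_apply continuousOn_snd
  -- positive lower bound
  obtain ⟨m₀, hm₀, hm₀'⟩ : ∃ m₀ : ℝ, 0 < m₀ ∧
      ∀ z ∈ (Metric.sphere x₀ (R / 2) ∩ Metric.closedBall y R) ×ˢ S, m₀ ≤ Q z := by
    apply IsCompact.exists_forall_le'
    · exact ((isCompact_sphere _ _).inter_right Metric.isClosed_closedBall).prod hScomp
    · refine hQc.mono ?_
      rintro z ⟨hz, _⟩
      exact ⟨hsub (Metric.sphere_subset_closedBall hz.1), trivial⟩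
    · rintro ⟨x, ξ⟩ ⟨⟨hx1, hx2⟩, hξ⟩
      have hxΩ : x ∈ Ω := hsub (Metric.sphere_subset_closedBall hx1)
      rw [hQdd x hxΩ]
      refine lt_of_le_of_ne (dd_nonneg hΩ hu hconv hxΩ ξ) (fun h => ?_)
      have hne : x ≠ x₀ := by
        rintro rfl
        simp only [Metric.mem_sphere, dist_self] at hx1
        linarith
      refine hfree x hx2 hne hxΩ ((det_zero_iff hΩ hu hconv hxΩ).2 ⟨ξ, ?_, h.symm⟩)
      simpa [hS] using hξ
  obtain ⟨ε, hε⟩ : ∃ ε : ℝ, ε = m₀ / 2 := ⟨_, rfl⟩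
  have hε0 : 0 < ε := by rw [hε]; positivity
  obtain ⟨c₀, hc₀⟩ : ∃ c₀ : ℝ, c₀ = - (ε * Real.exp (-α * R ^ 2)) := ⟨_, rfl⟩
  have hbarc : Continuous (bar α ε c₀ y) := (bar_contDiff α ε c₀ y).continuous
  obtain ⟨⟨z, ξ₁⟩, ⟨hzB, hξ₁⟩, hzmin⟩ : ∃ z ∈ Metric.closedBall x₀ (R / 2) ×ˢ S,
      IsMinOn (fun z => Q z - bar α ε c₀ y z.1) (Metric.closedBall x₀ (R / 2) ×ˢ S) z := by
    apply ((isCompact_closedBall _ _).prod hScomp).exists_isMinOn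
    · obtain ⟨ξ, hξ, _⟩ := (det_zero_iff hΩ hu hconv hx₀Ω).1 hx₀
      exact ⟨(x₀, ξ), Metric.mem_closedBall_self (by positivity), by simpa [hS] using hξ⟩
    · refine ContinuousOn.sub (hQc.mono ?_) (hbarc.comp continuous_fst).continuousOn
      rintro z ⟨hz, _⟩
      exact ⟨hsub hz, trivial⟩
  simp only at hzB hξ₁
  have hzΩ : z ∈ Ω := hsub hzB
  have hle0 : Q (z, ξ₁) - bar α ε c₀ y z ≤ 0 := by
    obtain ⟨ξ, hξ, hξ0⟩ := (det_zero_iff hΩ hu hconv hx₀Ω).1 hx₀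
    have h1 := hzmin (show (x₀, ξ) ∈ Metric.closedBall x₀ (R / 2) ×ˢ S from
      ⟨Metric.mem_closedBall_self (by positivity), by simpa [hS] using hξ⟩)
    simp only [Set.mem_ofPred_eq] at h1
    rw [hQdd x₀ hx₀Ω, hξ0] at h1
    have : bar α ε c₀ y x₀ = 0 := by simp [bar, hxy, hc₀]
    linarith
  -- interior
  have hzint : z ∈ Metric.ball x₀ (R / 2) := by
    rw [Metric.mem_ball]
    refine lt_of_le_of_ne hzB (fun hzs => ?_)
    by_cases hzy : z ∈ Metric.closedBall y R
    · have h1 := hm₀' (z, ξ₁) ⟨⟨hzs, hzy⟩, hξ₁⟩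
      have h2 : bar α ε c₀ y z ≤ ε := by
        have : Real.exp (-α * ‖z - y‖ ^ 2) ≤ 1 := by
          rw [Real.exp_le_one_iff]; nlinarith [sq_nonneg ‖z - y‖]
        have h3 : 0 < ε * Real.exp (-α * R ^ 2) := by positivity
        simp only [bar, hc₀]
        nlinarith
      linarith
    · rw [Metric.mem_closedBall, not_le, dist_eq_norm] at hzy
      have h1 : bar α ε c₀ y z < 0 := by
        have : Real.exp (-α * ‖z - y‖ ^ 2) < Real.exp (-α * R ^ 2) := by
          rw [Real.exp_lt_exp]
          have : R ^ 2 < ‖z - y‖ ^ 2 := by gcongr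
          nlinarith
        simp only [bar, hc₀]
        nlinarith
      have h2 := dd_nonneg hΩ hu hconv hzΩ ξ₁
      rw [← hQdd z hzΩ] at h2
      linarith
  set m := Q (z, ξ₁) - bar α ε c₀ y z with hm
  have hbarm : ∀ x, bar α ε (c₀ + m) y x = bar α ε c₀ y x + m := fun x => by simp [bar]; ring
  have hnξ₁ : ‖ξ₁‖ = 1 := by simpa [hS] using hξ₁
  have hlow : ∀ᶠ x in nhds z, ∀ ξ, bar α ε (c₀ + m) y x * ‖ξ‖ ^ 2 ≤ dd ξ (dd ξ u) x := by
    filter_upwards [Metric.isOpen_ball.mem_nhds hzint] with x hx ξ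
    have hxB := Metric.ball_subset_closedBall hx
    rw [← hQdd x (hsub hxB)]
    by_cases hξ : ξ = 0
    · simp [hξ, hQ]
    have hnξ : ‖ξ‖ ≠ 0 := norm_ne_zero_iff.2 hξ
    have h1 := hzmin (show (x, (‖ξ‖⁻¹ : ℝ) • ξ) ∈ Metric.closedBall x₀ (R / 2) ×ˢ S from
      ⟨hxB, by simp [hS, norm_smul, hnξ]⟩)
    simp only [Set.mem_ofPred_eq] at h1
    have h2 : Q (x, (‖ξ‖⁻¹ : ℝ) • ξ) = Q (x, ξ) / ‖ξ‖ ^ 2 := by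
      simp only [hQ, map_smul, smul_apply, smul_eq_mul]
      field_simp
    rw [h2] at h1
    have h3 : bar α ε (c₀ + m) y x ≤ Q (x, ξ) / ‖ξ‖ ^ 2 := by
      rw [hbarm]; linarith
    rwa [le_div_iff₀ (by positivity)] at h3
  have hψz : bar α ε (c₀ + m) y z = dd ξ₁ (dd ξ₁ u) z := by
    rw [hbarm, ← hQdd z hzΩ, hm]; ring
  obtain ⟨b, i, hbi⟩ := key hn hΩ hG hGpos hG' hGG'' hu heq hzΩ
    (ψ := bar α ε (c₀ + m) y) (bar_contDiff _ _ _ _).contDiffOn hlow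
    (ξ₀ := ξ₁) (by rw [← norm_ne_zero_iff, hnξ₁]; norm_num)
    (by rw [hnξ₁, hψz]; ring) (by rw [hψz]; exact dd_nonneg hΩ hu hconv hzΩ ξ₁)
  have hnb : ∀ k, ‖b k‖ = 1 := fun k => b.orthonormal.1 k
  set ρ := ‖z - y‖ with hρ
  set e := Real.exp (-α * ρ ^ 2) with he
  have he0 : 0 < e := Real.exp_pos _
  have hL : ∑ k, dd (b k) (dd (b k) (bar α ε (c₀ + m) y)) z
      = ε * (4 * α ^ 2 * ρ ^ 2 - 2 * α * n) * e := by
    simp_rw [bar_dd2, hnb]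
    rw [← Finset.sum_mul, ← Finset.mul_sum, Finset.sum_sub_distrib, ← Finset.mul_sum,
      b.sum_sq_inner_left]
    rw [Finset.sum_const, Finset.card_univ, Fintype.card_fin, nsmul_eq_mul, ← hρ, ← he]
    ring
  have hd : |dd (b i) (bar α ε (c₀ + m) y) z| ≤ 2 * α * ε * ρ * e := by
    rw [bar_dd, ← hρ, ← he, abs_mul (-2 * α * ε), abs_mul _ e, abs_of_pos he0]
    have h1 : |(inner ℝ (z - y) (b i) : ℝ)| ≤ ρ := by
      have := abs_real_inner_le_norm (z - y) (b i)
      rwa [hnb, mul_one] at this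
    have h2 : |-2 * α * ε| = 2 * α * ε := by
      rw [show -2 * α * ε = -(2 * α * ε) by ring, abs_neg, abs_of_pos (by positivity)]
    rw [h2]
    calc 2 * α * ε * (|(inner ℝ (z - y) (b i) : ℝ)| * e) ≤ 2 * α * ε * (ρ * e) := by gcongr
      _ = _ := by ring
  have hui : |dd (b i) u z| ≤ ‖fderiv ℝ u z‖ := by
    have := (fderiv ℝ u z).le_opNorm (b i)
    rwa [hnb, mul_one] at this
  have hCz := (le_abs_self _).trans (hC z hzB)
  have hg := hGpos (u z)
  rw [div_le_iff₀ hg] at hCz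
  rw [hL] at hbi
  have hfin : ε * (4 * α ^ 2 * ρ ^ 2 - 2 * α * n) * e * G (u z)
      ≤ (C * G (u z)) * (2 * α * ε * ρ * e) := by
    refine hbi.trans ?_
    calc 4 * n * |deriv G (u z)| * |dd (b i) u z| * |dd (b i) (bar α ε (c₀ + m) y) z|
        ≤ 4 * n * |deriv G (u z)| * ‖fderiv ℝ u z‖ * (2 * α * ε * ρ * e) := by gcongr
      _ ≤ _ := by gcongr
  have hfin2 : 2 * α * ρ ^ 2 - n ≤ C * ρ := by
    have hpos : 0 < 2 * α * ε * e * G (u z) := by positivity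
    refine le_of_mul_le_mul_left ?_ hpos
    linarith
  have hρR : R / 2 ≤ ρ := by
    have h1 : ‖x₀ - y‖ ≤ ‖x₀ - z‖ + ‖z - y‖ := norm_sub_le_norm_sub_add_norm_sub _ _ _
    rw [Metric.mem_closedBall, dist_eq_norm, norm_sub_rev] at hzB
    linarith
  have hn0 : (2 : ℝ) ≤ n := by exact_mod_cast hn
  have h1 : C ≤ α * ρ := by
    have : 2 * C / R * (R / 2) = C := by field_simp
    calc C = 2 * C / R * (R / 2) := this.symm
      _ ≤ α * ρ := by
        apply mul_le_mul _ hρR (by positivity) hα0.le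
        rw [hα]
        have : 0 ≤ 4 * (n : ℝ) / R ^ 2 := by positivity
        linarith
  have h2 : (n : ℝ) < α * ρ ^ 2 := by
    have : 4 * (n : ℝ) / R ^ 2 * (R / 2) ^ 2 = n := by field_simp; norm_num
    calc (n : ℝ) = 4 * n / R ^ 2 * (R / 2) ^ 2 := this.symm
      _ < α * (R / 2) ^ 2 := by
        apply mul_lt_mul_of_pos_right _ (by positivity)
        rw [hα]
        have : 0 ≤ 2 * C / R := by positivity
        linarith
      _ ≤ α * ρ ^ 2 := by gcongr
  have hρ0 : 0 ≤ ρ := norm_nonneg _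
  nlinarith [mul_le_mul_of_nonneg_right h1 hρ0]

theorem zero_all (hn : 2 ≤ n) (hΩ : IsOpen Ω) (hΩc : IsConnected Ω)
    {G : ℝ → ℝ} (hG : ContDiff ℝ (⊤ : ℕ∞) G) (hGpos : ∀ t, 0 < G t)
    (hG' : ∀ t, deriv G t < 0)
    (hGG'' : ∀ t, G t * deriv (deriv G) t ≤ ((n : ℝ) / ((n : ℝ) - 1)) * (deriv G t) ^ 2)
    (hu : Sm Ω u)
    (hconv : ∀ x ∈ Ω, (hessian u x).PosSemidef)
    (heq : ∀ x ∈ Ω, ∑ i, hessian u x i i = G (u x))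
    {p : EuclideanSpace ℝ (Fin n)} (hp : p ∈ Ω) (hp0 : (hessian u p).det = 0) :
    ∀ x ∈ Ω, (hessian u x).det = 0 := by
  have hdc : ContinuousOn (fun x => (hessian u x).det) Ω := by
    have h1 : Sm Ω (fun x => (Matrix.of fun i j => dd (EuclideanSpace.basisFun (Fin n) ℝ i)
        (dd (EuclideanSpace.basisFun (Fin n) ℝ j) u) x).det) :=
      Sm.det (fun i j => (hu.dd hΩ _).dd hΩ _)
    exact (ContDiffOn.continuousOn h1).congr (fun x hx => (det_eq hu hΩ hx _).symm)
  set Z : Set (EuclideanSpace ℝ (Fin n)) := {x | x ∈ Ω ∧ (hessian u x).det = 0} with hZ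
  set V : Set (EuclideanSpace ℝ (Fin n)) := {x | x ∈ Ω ∧ (hessian u x).det ≠ 0} with hV
  have hVo : IsOpen V := hdc.isOpen_inter_preimage hΩ isOpen_ne
  have hZo : IsOpen Z := by
    by_contra hno
    rw [isOpen_iff_mem_nhds] at hno
    push Not at hno
    obtain ⟨z₀, hz₀, hz₀n⟩ := hno
    obtain ⟨r, hr, hrΩ⟩ := Metric.nhds_basis_closedBall.mem_iff.1 (hΩ.mem_nhds hz₀.1)
    have hnb : ¬ Metric.ball z₀ (r / 4) ⊆ Z := fun h =>
      hz₀n (Filter.mem_of_superset (Metric.ball_mem_nhds _ (by positivity)) h)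
    obtain ⟨y₀, hy₀, hy₀Z⟩ := Set.not_subset.1 hnb
    rw [Metric.mem_ball] at hy₀
    have hKc : IsCompact (Metric.closedBall z₀ r ∩ {x | (hessian u x).det = 0}) := by
      refine (isCompact_closedBall z₀ r).of_isClosed_subset ?_ Set.inter_subset_left
      exact (hdc.mono hrΩ).preimage_isClosed_of_isClosed Metric.isClosed_closedBall
        (isClosed_singleton (x := (0:ℝ)))
    obtain ⟨x₀, hx₀, hx₀m⟩ := hKc.exists_isMinOn (f := fun x => dist y₀ x)
      ⟨z₀, Metric.mem_closedBall_self hr.le, hz₀.2⟩ (by fun_prop)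
    have hmin : ∀ x, x ∈ Metric.closedBall z₀ r → (hessian u x).det = 0 →
      dist y₀ x₀ ≤ dist y₀ x := fun x h1 h2 => hx₀m ⟨h1, h2⟩
    have hR0 : dist y₀ x₀ < r / 4 :=
      (hmin z₀ (Metric.mem_closedBall_self hr.le) hz₀.2).trans_lt hy₀
    have hx₀z : dist x₀ z₀ < r / 2 := by
      have := dist_triangle x₀ y₀ z₀
      rw [dist_comm x₀ y₀] at this
      linarith
    have hRpos : 0 < dist y₀ x₀ := by
      rw [dist_pos]
      rintro rfl
      exact hy₀Z ⟨hrΩ hx₀.1, hx₀.2⟩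
    obtain ⟨y, hy⟩ : ∃ y, y = (1 / 2 : ℝ) • (x₀ + y₀) := ⟨_, rfl⟩
    have hyx : x₀ - y = (1 / 2 : ℝ) • (x₀ - y₀) := by rw [hy]; module
    have hyy : y - y₀ = (1 / 2 : ℝ) • (x₀ - y₀) := by rw [hy]; module
    have hnn : ‖(1 / 2 : ℝ) • (x₀ - y₀)‖ = dist y₀ x₀ / 2 := by
      rw [norm_smul, dist_comm, dist_eq_norm]; norm_num; ring
    refine no_touch hn hΩ hG hGpos hG' hGG'' hu hconv heq (x₀ := x₀) (y := y)
      (R := dist y₀ x₀ / 2) (by positivity) (by rw [hyx, hnn]) ?_ hx₀.2 ?_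
    · intro x hx
      apply hrΩ
      rw [Metric.mem_closedBall] at hx ⊢
      have := dist_triangle x x₀ z₀
      linarith
    · intro x hx hne hxΩ hdet
      rw [Metric.mem_closedBall, dist_eq_norm] at hx
      have h1 : dist x y₀ ≤ dist y₀ x₀ := by
        rw [dist_eq_norm]
        have : ‖x - y₀‖ ≤ ‖x - y‖ + ‖y - y₀‖ := norm_sub_le_norm_sub_add_norm_sub _ _ _
        rw [hyy, hnn] at this
        linarith
      have h2 : x ∈ Metric.closedBall z₀ r := by
        rw [Metric.mem_closedBall]
        have := dist_triangle x y₀ z₀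
        linarith
      have h3 := hmin x h2 hdet
      have hpl := parallelogram_law_with_norm ℝ (x - y) (x₀ - y)
      have e1 : x - y + (x₀ - y) = x - y₀ := by rw [hy]; module
      have e2 : x - y - (x₀ - y) = x - x₀ := by abel
      rw [e1, e2, hyx, hnn, ← dist_eq_norm x y₀, dist_comm x y₀] at hpl
      have h4 : 0 < ‖x - x₀‖ := norm_pos_iff.2 (sub_ne_zero.2 hne)
      have h5 : ‖x - y‖ ^ 2 ≤ (dist y₀ x₀ / 2) ^ 2 := by gcongr
      have h6 : dist y₀ x₀ ^ 2 ≤ dist y₀ x ^ 2 := by gcongr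
      nlinarith [sq_pos_of_pos h4]
  have hdis : Disjoint Z V := Set.disjoint_left.2 fun x h1 h2 => h2.2 h1.2
  have hcov : Ω ⊆ Z ∪ V := fun x hx => by
    by_cases h : (hessian u x).det = 0
    · exact Or.inl ⟨hx, h⟩
    · exact Or.inr ⟨hx, h⟩
  have := hΩc.isPreconnected.subset_left_of_subset_union hZo hVo hdis hcov ⟨p, hp, hp, hp0⟩
  exact fun x hx => (this hx).2
end Zero

/-- **Stronger constant rank theorem for σₙ** (Theorem 1.4): if `u` is a smooth convex
solution of `Δu = G(u)` on an open connected `Ω ⊆ ℝⁿ` (`n ≥ 2`), with `G > 0`, `G' < 0`,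
`G·G'' ≤ (n/(n−1))·(G')²`, and `det (D²u)` attains a local minimum at an interior point
of `Ω`, then `det (D²u) ≡ 0` in `Ω`. -/
theorem stmt_2 (n : ℕ) (hn : 2 ≤ n)
    (Ω : Set (EuclideanSpace ℝ (Fin n))) (hΩopen : IsOpen Ω) (hΩconn : IsConnected Ω)
    (G : ℝ → ℝ)
    (hG : ContDiff ℝ (⊤ : ℕ∞) G)
    (hGpos : ∀ t, 0 < G t)
    (hG' : ∀ t, deriv G t < 0)
    (hGG'' : ∀ t, G t * deriv (deriv G) t ≤ ((n : ℝ) / ((n : ℝ) - 1)) * (deriv G t) ^ 2)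
    (u : EuclideanSpace ℝ (Fin n) → ℝ) (hu : ContDiffOn ℝ (⊤ : ℕ∞) u Ω)
    (hconv : ∀ x ∈ Ω, (hessian u x).PosSemidef)
    (heq : ∀ x ∈ Ω, ∑ i, hessian u x i i = G (u x))
    (p : EuclideanSpace ℝ (Fin n)) (hp : p ∈ Ω)
    (hmin : IsLocalMin (fun x => (hessian u x).det) p) :
    ∀ x ∈ Ω, (hessian u x).det = 0 := by
  exact zero_all hn hΩopen hΩconn hG hGpos hG' hGG'' hu hconv heq hp
    (pos_case hn hΩopen hG hG' hGG'' hu hconv heq hp hmin)
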